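/- Let m(n) denote the maximum, over all permutations p of {1,...,n}, of the minimum number of applications of SC_231 needed to map p into the set of peakless permutations. Then m(n) ≤ (n+1)(n-2)/2 for all n ≥ 3. -/

import Mathlib

/-- One step-by-step implementation of the `SC_231` stack-sorting machine.
`sc231Aux input stack out`: the next input entry is pushed onto the stack unless
pushing it would create a consecutive occurrence of the pattern `231` read from
top to bottom among the stack entries (i.e. the incoming `x` on top of `y`, `z`
with `z < x < y`), in which case the top of the stack is popped and appended to
the output; once the input is exhausted the remaining stack entries are popped. -/
def sc231Aux : List ℕ → List ℕ → List ℕ → List ℕ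
  | [], stack, out => out ++ stack
  | x :: rest, y :: z :: s, out =>
      if z < x ∧ x < y then sc231Aux (x :: rest) (z :: s) (out ++ [y])
      else sc231Aux rest (x :: y :: z :: s) out
  | x :: rest, stack, out => sc231Aux rest (x :: stack) out
termination_by input stack _ => 2 * input.length + stack.length
decreasing_by all_goals (simp; try omega)

/-- The consecutive-pattern-avoiding stack sort map `SC_231`. -/
def SC231 (p : List ℕ) : List ℕ := sc231Aux p [] []

/-- The list of entries that are *pre-popped* while `SC_231` processes the
input, i.e. popped while input entries still remain. -/
def prePopsAux : List ℕ → List ℕ → List ℕ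
  | [], _ => []
  | x :: rest, y :: z :: s =>
      if z < x ∧ x < y then y :: prePopsAux (x :: rest) (z :: s)
      else prePopsAux rest (x :: y :: z :: s)
  | x :: rest, stack => prePopsAux rest (x :: stack)
termination_by input stack => 2 * input.length + stack.length
decreasing_by all_goals (simp; try omega)

def prePops (p : List ℕ) : List ℕ := prePopsAux p []

/-- `p` has a peak: an interior position whose entry exceeds both neighbours. -/
def HasPeak (p : List ℕ) : Prop :=
  ∃ i, i + 2 < p.length ∧ p[i]! < p[i+1]! ∧ p[i+2]! < p[i+1]!

/-- `p` is a permutation of `{1, …, n}` (written as a list of its entries). -/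
def IsPermOf (n : ℕ) (p : List ℕ) : Prop := p.Perm (List.range' 1 n)

/-- `p` contains the (classical) pattern `q`. -/
def ContainsPat (p q : List ℕ) : Prop :=
  ∃ s : List ℕ, s.Sublist p ∧ s.length = q.length ∧
    ∀ i j, i < s.length → j < s.length → (s[i]! < s[j]! ↔ q[i]! < q[j]!)

def AvoidsPat (p q : List ℕ) : Prop := ¬ ContainsPat p q

/-- The sort-number of `p`: the least `k` with `SC_231^k(p)` peakless. -/
noncomputable def sortNum (p : List ℕ) : ℕ := sInf {k | ¬ HasPeak (SC231^[k] p)}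

/-- One input entry of the `SC_231` machine, acting on the pair (stack, output).
At most one entry is popped before the push. -/
def pushStep : List ℕ × List ℕ → ℕ → List ℕ × List ℕ
  | (y :: z :: s, o), x =>
      if z < x ∧ x < y then (x :: z :: s, o ++ [y]) else (x :: y :: z :: s, o)
  | (s, o), x => (x :: s, o)

/-- The stack and the output once all of `p` has been read. -/
def runStack (p : List ℕ) : List ℕ × List ℕ := p.foldl pushStep ([], [])

/-- No entry of `p` of value at most `m` has smaller entries on both sides. -/
def PeaklessUpTo (m : ℕ) (p : List ℕ) : Prop :=
  ∀ a b c, [a, b, c].Sublist p → b ≤ m → ¬ (a < b ∧ c < b)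

/-- `p` has no three adjacent entries forming the pattern `231`. -/
def NoAdjacent231 (p : List ℕ) : Prop :=
  ∀ u a b c v, p = u ++ a :: b :: c :: v → ¬ (c < a ∧ a < b)

/-- The pushing rule: either the top `y` is popped or `x` is simply pushed. -/
lemma pushStep_cases (s o : List ℕ) (x : ℕ) :
    (∃ y z t, s = y :: z :: t ∧ z < x ∧ x < y ∧ pushStep (s, o) x = (x :: z :: t, o ++ [y])) ∨
      ((∀ y z t, s = y :: z :: t → ¬ (z < x ∧ x < y)) ∧ pushStep (s, o) x = (x :: s, o)) := by
  match s with
  | [] => right; simp [pushStep]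
  | [y] => right; simp [pushStep]
  | y :: z :: t =>
    by_cases h : z < x ∧ x < y
    · left; exact ⟨y, z, t, rfl, h.1, h.2, by simp [pushStep, h]⟩
    · right
      refine ⟨?_, by simp [pushStep, h]⟩
      rintro _ _ _ ⟨⟩
      exact h

lemma sc231Aux_eq_foldl (p s o : List ℕ) :
    sc231Aux p s o = (p.foldl pushStep (s, o)).2 ++ (p.foldl pushStep (s, o)).1 := by
  fun_induction sc231Aux p s o with
  | case1 => simp
  | case2 x rest y z s o h ih =>
    rw [ih, List.foldl_cons, List.foldl_cons]
    congr 3 <;>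
    · rcases pushStep_cases (z :: s) (o ++ [y]) x with ⟨y', z', t, h1, h2, h3, -⟩ | ⟨-, h1⟩
      · simp only [List.cons.injEq] at h1
        omega
      · rw [h1]; simp [pushStep, h]
  | case3 x rest y z s o h ih => rw [ih]; simp [pushStep, h]
  | case4 x rest s o hs ih =>
    rw [ih, List.foldl_cons]
    congr 3 <;>
    · rcases pushStep_cases s o x with ⟨y', z', t, h1, -⟩ | ⟨-, h1⟩
      · exact (hs _ _ _ h1).elim
      · exact h1.symm

lemma SC231_eq (p : List ℕ) : SC231 p = (runStack p).2 ++ (runStack p).1 :=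
  sc231Aux_eq_foldl p [] []

lemma foldl_pushStep_perm (p s o : List ℕ) :
    ((p.foldl pushStep (s, o)).2 ++ (p.foldl pushStep (s, o)).1).Perm (o ++ s ++ p) := by
  induction p generalizing s o with
  | nil => simp
  | cons x p ih =>
    rw [List.foldl_cons]
    rcases pushStep_cases s o x with ⟨y, z, t, rfl, -, -, h⟩ | ⟨-, h⟩ <;> rw [h] <;>
    · refine (ih _ _).trans ?_
      rw [List.perm_iff_count]
      intro a
      simp only [List.count_append, List.count_cons, List.count_nil]
      omega

lemma SC231_perm (p : List ℕ) : (SC231 p).Perm p := by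
  rw [SC231_eq]
  simpa [runStack] using foldl_pushStep_perm p [] []

lemma foldl_pushStep_sublist (p s o : List ℕ) :
    (p.foldl pushStep (s, o)).1.reverse.Sublist (s.reverse ++ p) := by
  induction p generalizing s o with
  | nil => simp
  | cons x p ih =>
    rw [List.foldl_cons]
    rcases pushStep_cases s o x with ⟨y, z, t, rfl, -, -, h⟩ | ⟨-, h⟩ <;> rw [h] <;>
      refine (ih _ _).trans ?_ <;> simp

lemma runStack_sublist (p : List ℕ) : (runStack p).1.reverse.Sublist p := by
  simpa [runStack] using foldl_pushStep_sublist p [] []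

lemma mem_foldl_pushStep_output (p s o : List ℕ) {e : ℕ} (he : e ∈ o) :
    e ∈ (p.foldl pushStep (s, o)).2 := by
  induction p generalizing s o with
  | nil => simpa
  | cons x p ih =>
    rw [List.foldl_cons]
    rcases pushStep_cases s o x with ⟨y, z, t, rfl, -, -, h⟩ | ⟨-, h⟩ <;> rw [h] <;>
      apply ih <;> simp [he]

lemma PeaklessUpTo.sublist {m : ℕ} {p q : List ℕ} (h : PeaklessUpTo m p) (hq : q.Sublist p) :
    PeaklessUpTo m q :=
  fun a b c hs => h a b c (hs.trans hq)

lemma foldl_pushStep_output_gt {k : ℕ} (p s o : List ℕ) (hp : PeaklessUpTo k (s.reverse ++ p))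
    (ho : ∀ e ∈ o, k < e) : ∀ e ∈ (p.foldl pushStep (s, o)).2, k < e := by
  induction p generalizing s o with
  | nil => exact ho
  | cons x p ih =>
    rw [List.foldl_cons]
    rcases pushStep_cases s o x with ⟨y, z, t, rfl, h1, h2, h⟩ | ⟨-, h⟩ <;> rw [h]
    · refine ih _ _ (hp.sublist (by simp)) ?_
      intro e he
      rcases List.mem_append.1 he with he | he
      · exact ho e he
      · rw [List.mem_singleton.1 he]
        by_contra! hy
        refine hp z y x ?_ hy ⟨by omega, h2⟩
        simp
    · exact ih _ _ (hp.sublist (by simp)) ho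

lemma runStack_output_gt {k : ℕ} {p : List ℕ} (hp : PeaklessUpTo k p) :
    ∀ e ∈ (runStack p).2, k < e :=
  foldl_pushStep_output_gt p [] [] hp (by simp)

lemma foldl_pushStep_noAdjacent231 (p s o : List ℕ) (hs : NoAdjacent231 s) :
    NoAdjacent231 (p.foldl pushStep (s, o)).1 := by
  induction p generalizing s o with
  | nil => simpa
  | cons x p ih =>
    rw [List.foldl_cons]
    rcases pushStep_cases s o x with ⟨y, z, t, rfl, h1, h2, h⟩ | ⟨h', h⟩ <;> rw [h] <;> apply ih
    · rintro (_ | ⟨d, u⟩) a b c v huv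
      · simp only [List.nil_append, List.cons.injEq] at huv
        omega
      · simp only [List.cons_append, List.cons.injEq] at huv
        exact hs (y :: u) a b c v (by simp [huv.2])
    · rintro (_ | ⟨d, u⟩) a b c v huv
      · simp only [List.nil_append, List.cons.injEq] at huv
        rw [← huv.1]
        exact h' b c v huv.2
      · simp only [List.cons_append, List.cons.injEq] at huv
        exact hs u a b c v huv.2

lemma runStack_noAdjacent231 (p : List ℕ) : NoAdjacent231 (runStack p).1 :=
  foldl_pushStep_noAdjacent231 p [] [] (by simp [NoAdjacent231])

lemma NoAdjacent231.infix {p q : List ℕ} (h : NoAdjacent231 p) (hq : q <:+: p) :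
    NoAdjacent231 q := by
  obtain ⟨u', v', rfl⟩ := hq
  rintro u a b c v rfl
  exact h (u' ++ u) a b c (v ++ v') (by simp)

lemma exists_pushStep_stack (s o : List ℕ) (x : ℕ) :
    ∃ t o', pushStep (s, o) x = (x :: t, o') := by
  rcases pushStep_cases s o x with ⟨y, z, t, rfl, h1, h2, h⟩ | ⟨h', h⟩ <;> exact ⟨_, _, h⟩

/-- The middle entry of an adjacent `132` is popped early. -/
lemma mem_runStack_output_of_adjacent132 (u v : List ℕ) {a b c : ℕ} (hac : a < c) (hcb : c < b) :
    b ∈ (runStack (u ++ a :: b :: c :: v)).2 := by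
  unfold runStack
  rw [List.foldl_append, List.foldl_cons]
  obtain ⟨t, o, h⟩ := exists_pushStep_stack (u.foldl pushStep ([], [])).1
    (u.foldl pushStep ([], [])).2 a
  rw [Prod.mk.eta] at h
  rw [h, List.foldl_cons, List.foldl_cons]
  have hb : pushStep (a :: t, o) b = (b :: a :: t, o) := by
    rcases pushStep_cases (a :: t) o b with ⟨y, z, t', h1, h2, h3, -⟩ | ⟨-, h⟩
    · simp only [List.cons.injEq] at h1
      omega
    · exact h
  have hc : pushStep (b :: a :: t, o) c = (c :: a :: t, o ++ [b]) := by
    simp [pushStep, hac, hcb]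
  rw [hb, hc]
  exact mem_foldl_pushStep_output _ _ _ (by simp)

/-- A block of entries exceeding both of its neighbours contains an adjacent peak. -/
lemma exists_adjacent_peak (w : List ℕ) (z x b₀ : ℕ) (hz : z < b₀) (hx : ∀ e ∈ b₀ :: w, x < e)
    (hw : (b₀ :: w).Nodup) :
    ∃ u a b c v, z :: b₀ :: w ++ [x] = u ++ a :: b :: c :: v ∧ a < b ∧ c < b ∧ b ∈ b₀ :: w := by
  induction w generalizing z b₀ with
  | nil => exact ⟨[], z, b₀, x, [], by simp, hz, hx b₀ (by simp), by simp⟩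
  | cons b₁ w ih =>
    rcases lt_trichotomy b₁ b₀ with h | h | h
    · exact ⟨[], z, b₀, b₁, w ++ [x], by simp, hz, h, by simp⟩
    · simp [h] at hw
    · obtain ⟨u, a, b, c, v, h1, h2, h3, h4⟩ := ih b₀ b₁ h
        (fun e he => hx e (List.mem_cons_of_mem _ he)) (List.nodup_cons.1 hw).2
      exact ⟨z :: u, a, b, c, v, by simpa using h1, h2, h3, List.mem_cons_of_mem _ h4⟩

/-- A sublist containing the pivot of a duplicate-free list splits at that pivot. -/
lemma List.Sublist.split_at_mem {α : Type*} {l L R : List α} {z : α} (h : l.Sublist (L ++ z :: R))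
    (hz : z ∈ l) (hn : (L ++ z :: R).Nodup) :
    ∃ L' R', l = L' ++ z :: R' ∧ L'.Sublist L ∧ R'.Sublist R := by
  obtain ⟨L', M, rfl, hL, hM⟩ := List.sublist_append_iff.1 h
  have hn' := List.nodup_middle.1 hn
  rw [List.nodup_cons, List.mem_append, not_or] at hn'
  rcases List.sublist_cons_iff.1 hM with hM | ⟨R', rfl, hR⟩
  · rcases List.mem_append.1 hz with hz | hz
    · exact (hn'.1.1 (hL.subset hz)).elim
    · exact (hn'.1.2 (hM.subset hz)).elim
  · exact ⟨L', R', rfl, hL, hR⟩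

/-- `w` is a block of entries of `p`, one of them `m` and all of them at least `m`, which stands
between the entries `z` and `x`, both smaller than `m`. -/
structure IsBlock (m : ℕ) (p : List ℕ) (z : ℕ) (w : List ℕ) (x : ℕ) : Prop where
  isInfix : z :: w ++ [x] <:+: p
  mem : m ∈ w
  left_lt : z < m
  right_lt : x < m
  le : ∀ e ∈ w, m ≤ e

lemma exists_split_first (m : ℕ) (l : List ℕ) {c : ℕ} (hc : c ∈ l) (hcm : c < m) :
    ∃ w x R, l = w ++ x :: R ∧ x < m ∧ ∀ e ∈ w, m ≤ e := by
  induction l with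
  | nil => simp at hc
  | cons d l ih =>
    by_cases hd : d < m
    · exact ⟨[], d, l, rfl, hd, by simp⟩
    · have hcl : c ∈ l := by
        rcases List.mem_cons.1 hc with rfl | h
        · exact (hd hcm).elim
        · exact h
      obtain ⟨w, x, R, rfl, hx, hw⟩ := ih hcl
      refine ⟨d :: w, x, R, rfl, hx, ?_⟩
      rintro e (_ | ⟨_, he⟩)
      · omega
      · exact hw e he

lemma exists_isBlock {k : ℕ} {p : List ℕ} (hp : PeaklessUpTo k p)
    (hp' : ¬ PeaklessUpTo (k + 1) p) : ∃ z w x, IsBlock (k + 1) p z w x := by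
  unfold PeaklessUpTo at hp'
  push Not at hp'
  obtain ⟨a, b, c, hs, hb, hab, hcb⟩ := hp'
  obtain rfl : b = k + 1 := by
    by_contra hne
    exact hp a b c hs (by omega) ⟨hab, hcb⟩
  obtain ⟨P, Q, rfl, hP, hQ⟩ := List.cons_sublist_iff.1 hs
  obtain ⟨Q₁, Q₂, rfl, hQ₁, hQ₂⟩ := List.cons_sublist_iff.1 hQ
  obtain ⟨A, B, rfl⟩ := List.append_of_mem hQ₁
  obtain ⟨w₁, z, L, h₁, hz, hw₁⟩ := exists_split_first (k + 1) (P ++ A).reverse (c := a)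
    (by simp [hP]) hab
  obtain ⟨w₂, x, R, h₂, hx, hw₂⟩ := exists_split_first (k + 1) (B ++ Q₂) (c := c)
    (by simp [List.singleton_sublist.1 hQ₂]) hcb
  have h₁' : P ++ A = L.reverse ++ z :: w₁.reverse := by
    rw [← List.reverse_inj, h₁]; simp
  refine ⟨z, w₁.reverse ++ (k + 1) :: w₂, x, ⟨L.reverse, R, ?_⟩, by simp, hz, hx, ?_⟩
  · calc _ = (L.reverse ++ z :: w₁.reverse) ++ (k + 1) :: (w₂ ++ x :: R) := by simp
      _ = _ := by rw [← h₁', ← h₂]; simp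
  · intro e he
    simp only [List.mem_append, List.mem_reverse, List.mem_cons] at he
    rcases he with he | rfl | he
    · exact hw₁ e he
    · exact le_rfl
    · exact hw₂ e he

lemma triple_sublist_of_SC231 {k : ℕ} {p : List ℕ} (hp : PeaklessUpTo k p) {a b c : ℕ}
    (h : [a, b, c].Sublist (SC231 p)) (ha : a ≤ k) :
    b ∈ (runStack p).1 ∧ [c, b, a].Sublist p := by
  rw [SC231_eq] at h
  have hao : a ∉ (runStack p).2 := fun h' => by
    have := runStack_output_gt hp a h'
    omega
  have hs : [a, b, c].Sublist (runStack p).1 := by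
    obtain ⟨l₁, l₂, h1, h2, h3⟩ := List.sublist_append_iff.1 h
    cases l₁ with
    | nil => rw [h1]; exact h3
    | cons d l =>
      simp only [List.cons_append, List.cons.injEq] at h1
      exact (hao (h2.subset (by simp [h1.1]))).elim
  exact ⟨hs.subset (by simp), by simpa using hs.reverse.trans (runStack_sublist p)⟩

lemma PeaklessUpTo.SC231 {k : ℕ} {p : List ℕ} (hp : PeaklessUpTo k p) :
    PeaklessUpTo k (SC231 p) := by
  intro a b c hs hb h
  exact hp c b a (triple_sublist_of_SC231 hp hs (by omega)).2 hb ⟨h.2, h.1⟩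

lemma PeaklessUpTo.SC231_succ {k : ℕ} {p : List ℕ} (hp : PeaklessUpTo k p) (hn : p.Nodup)
    (hk : k + 1 ∈ (runStack p).2) : PeaklessUpTo (k + 1) (_root_.SC231 p) := by
  intro a b c hs hb h
  obtain ⟨hbs, hs'⟩ := triple_sublist_of_SC231 hp hs (by omega)
  have hn' : (_root_.SC231 p).Nodup := (SC231_perm p).nodup_iff.2 hn
  rw [SC231_eq] at hn'
  have hne : b ≠ k + 1 := fun hbk => List.disjoint_of_nodup_append hn' hk (hbk ▸ hbs)
  exact hp c b a hs' (by omega) ⟨h.2, h.1⟩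

/-- One application of `SC_231` settles `k + 1`, or leaves a block around it that contains no
adjacent `231` and is shorter if the original block contained no adjacent `231`. -/
lemma IsBlock.SC231 {k : ℕ} {p w : List ℕ} {z x : ℕ} (h : IsBlock (k + 1) p z w x)
    (hp : PeaklessUpTo k p) (hn : p.Nodup) :
    PeaklessUpTo (k + 1) (SC231 p) ∨ ∃ w', IsBlock (k + 1) (SC231 p) x w' z ∧
      NoAdjacent231 (x :: w' ++ [z]) ∧ w'.length ≤ w.length ∧
      (NoAdjacent231 (z :: w ++ [x]) → w'.length < w.length) := by
  by_cases hk : k + 1 ∈ (runStack p).2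
  · exact Or.inl (hp.SC231_succ hn hk)
  right
  have hn' : (_root_.SC231 p).Nodup := (SC231_perm p).nodup_iff.2 hn
  rw [SC231_eq] at hn' ⊢
  have hdisj := List.disjoint_of_nodup_append hn'
  have hmem : ∀ e ∈ p, e ≤ k + 1 → e ∈ (runStack p).1 := by
    intro e he hek
    have : e ∈ (runStack p).2 ++ (runStack p).1 := by
      rw [← SC231_eq]; exact (SC231_perm p).mem_iff.2 he
    rcases List.mem_append.1 this with ho | hs
    · have := runStack_output_gt hp e ho
      obtain rfl : e = k + 1 := by omega
      exact (hk ho).elim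
    · exact hs
  obtain ⟨⟨L, R, hLR⟩, hmw, hz, hx, hle⟩ := h
  have hLR' : p = L ++ z :: (w ++ x :: R) := by rw [← hLR]; simp
  have hzs := hmem z (by simp [hLR']) hz.le
  have hxs := hmem x (by simp [hLR']) hx.le
  have hms := hmem (k + 1) (by simp [hLR', hmw]) le_rfl
  have hnd := hn
  rw [hLR'] at hnd
  have hsub : (runStack p).1.reverse.Sublist (L ++ z :: (w ++ x :: R)) :=
    (runStack_sublist p).trans (by rw [hLR'])
  obtain ⟨L', M, hM, hL', hMs⟩ := hsub.split_at_mem (List.mem_reverse.2 hzs) hnd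
  have hmid := List.nodup_middle.1 hnd
  simp only [List.nodup_cons, List.mem_append, List.mem_cons, not_or] at hmid
  have hwx : (w ++ x :: R).Nodup := (List.nodup_append.1 hmid.2).2.1
  have hdisjL := List.disjoint_of_nodup_append hmid.2
  have hmemM : ∀ e ∈ w ++ x :: R, e ∈ (runStack p).1 → e ∈ M := by
    intro e he hes
    rw [← List.mem_reverse, hM, List.mem_append, List.mem_cons] at hes
    rcases hes with hes | rfl | hes
    · exact (hdisjL (hL'.subset hes) he).elim
    · simp only [List.mem_append, List.mem_cons] at he
      tauto
    · exact hes
  obtain ⟨w', R', rfl, hw', hR'⟩ := hMs.split_at_mem (hmemM x (by simp) hxs) hwx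
  have hmw' : k + 1 ∈ w' := by
    have hR := (List.nodup_append.1 hwx).2.2 (k + 1) hmw
    rcases List.mem_append.1 (hmemM (k + 1) (by simp [hmw]) hms) with h | h
    · exact h
    · exact (hR (k + 1) (List.mem_cons.2
        ((List.mem_cons.1 h).imp_right fun h' => hR'.subset h')) rfl).elim
  have hs : (runStack p).1 = R'.reverse ++ (x :: w'.reverse ++ [z]) ++ L'.reverse := by
    rw [← List.reverse_inj, hM]; simp
  have hinf : x :: w'.reverse ++ [z] <:+: (runStack p).1 := ⟨_, _, hs.symm⟩
  refine ⟨w'.reverse, ⟨hinf.trans (List.suffix_append _ _).isInfix, by simpa, hx, hz, ?_⟩,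
    (runStack_noAdjacent231 p).infix hinf, by simpa using hw'.length_le, ?_⟩
  · intro e he
    exact hle e (hw'.subset (List.mem_reverse.1 he))
  · intro h231
    rw [List.length_reverse]
    refine lt_of_le_of_ne hw'.length_le fun hlen => ?_
    obtain rfl := hw'.eq_of_length hlen
    obtain ⟨b₀, w₀, rfl⟩ := List.exists_cons_of_ne_nil (List.ne_nil_of_mem hmw)
    obtain ⟨u, a, b, c, v, huv, hab, hcb, hbw⟩ := exists_adjacent_peak w₀ z x b₀
      (hz.trans_le (hle b₀ (by simp))) (fun e he => hx.trans_le (hle e he))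
      (List.nodup_append.1 hwx).1
    have hpu : p = (L ++ u) ++ a :: b :: c :: (v ++ R) := by
      rw [← hLR, huv]; simp
    have hac : a ≠ c := by
      rintro rfl
      simp [hpu, List.nodup_append] at hn
    have hca := h231 u a b c v huv
    have hbo := mem_runStack_output_of_adjacent132 (L ++ u) (v ++ R)
      (show a < c by omega) hcb
    rw [← hpu] at hbo
    refine hdisj hbo (hinf.subset ?_)
    simp only [List.cons_append, List.mem_cons, List.mem_append, List.mem_reverse]
    exact Or.inr (Or.inl (List.mem_cons.1 hbw))

lemma IsBlock.exists_iterate_of_noAdjacent231 {k N : ℕ} {p w : List ℕ} {z x : ℕ}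
    (h : IsBlock (k + 1) p z w x) (hp : PeaklessUpTo k p) (hn : p.Nodup)
    (h231 : NoAdjacent231 (z :: w ++ [x])) (hN : w.length ≤ N) :
    ∃ t ≤ N, PeaklessUpTo (k + 1) (_root_.SC231^[t] p) := by
  induction N generalizing p w z x with
  | zero =>
    have := List.length_pos_of_mem h.mem
    omega
  | succ N ih =>
    rcases h.SC231 hp hn with hk | ⟨w', h', h231', -, hlt⟩
    · exact ⟨1, by omega, hk⟩
    · have := hlt h231
      obtain ⟨t, ht, hk⟩ := ih h' hp.SC231 ((SC231_perm p).nodup_iff.2 hn) h231' (by omega)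
      exact ⟨t + 1, by omega, hk⟩

lemma IsBlock.exists_iterate {k : ℕ} {p w : List ℕ} {z x : ℕ}
    (h : IsBlock (k + 1) p z w x) (hp : PeaklessUpTo k p) (hn : p.Nodup) :
    ∃ t ≤ w.length + 1, PeaklessUpTo (k + 1) (_root_.SC231^[t] p) := by
  rcases h.SC231 hp hn with hk | ⟨w', h', h231', hle, -⟩
  · exact ⟨1, by omega, hk⟩
  · obtain ⟨t, ht, hk⟩ := h'.exists_iterate_of_noAdjacent231 hp.SC231
      ((SC231_perm p).nodup_iff.2 hn) h231' hle
    exact ⟨t + 1, by omega, hk⟩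

lemma IsPermOf.nodup {n : ℕ} {p : List ℕ} (hp : IsPermOf n p) : p.Nodup :=
  hp.nodup_iff.2 List.nodup_range'

lemma IsPermOf.mem_iff {n : ℕ} {p : List ℕ} (hp : IsPermOf n p) {e : ℕ} :
    e ∈ p ↔ 1 ≤ e ∧ e ≤ n := by
  rw [List.Perm.mem_iff hp, List.mem_range'_1]
  omega

lemma IsPermOf.iterate_SC231 {n : ℕ} {p : List ℕ} (hp : IsPermOf n p) (t : ℕ) :
    IsPermOf n (SC231^[t] p) := by
  induction t generalizing p with
  | zero => exact hp
  | succ t ih => exact ih ((SC231_perm p).trans hp)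

lemma IsBlock.length_add_le {n k : ℕ} {p w : List ℕ} {z x : ℕ} (h : IsBlock (k + 1) p z w x)
    (hp : IsPermOf n p) : w.length + k ≤ n := by
  have hinf : w <:+: p := List.IsInfix.trans ⟨[z], [x], by simp⟩ h.isInfix
  have hsub : w.toFinset ⊆ Finset.Icc (k + 1) n := by
    intro e he
    rw [List.mem_toFinset] at he
    exact Finset.mem_Icc.2 ⟨h.le e he, (hp.mem_iff.1 (hinf.subset he)).2⟩
  have hcard := Finset.card_le_card hsub
  rw [List.toFinset_card_of_nodup (hp.nodup.sublist hinf.sublist), Nat.card_Icc] at hcard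
  have := List.length_pos_of_mem h.mem
  omega

lemma IsPermOf.exists_iterate_peaklessUpTo_succ {n k : ℕ} {p : List ℕ} (hp : IsPermOf n p)
    (hk : PeaklessUpTo k p) (hkn : k ≤ n) :
    ∃ t ≤ n - k + 1, PeaklessUpTo (k + 1) (SC231^[t] p) := by
  by_cases hk' : PeaklessUpTo (k + 1) p
  · exact ⟨0, by omega, hk'⟩
  · obtain ⟨z, w, x, h⟩ := exists_isBlock hk hk'
    obtain ⟨t, ht, h'⟩ := h.exists_iterate hk hp.nodup
    have := h.length_add_le hp
    exact ⟨t, by omega, h'⟩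

lemma IsPermOf.peaklessUpTo_two {n : ℕ} {p : List ℕ} (hp : IsPermOf n p) :
    PeaklessUpTo 2 p := by
  intro a b c hs hb h
  have ha := (hp.mem_iff.1 (hs.subset (show a ∈ [a, b, c] by simp))).1
  have hc := (hp.mem_iff.1 (hs.subset (show c ∈ [a, b, c] by simp))).1
  have hn := hp.nodup.sublist hs
  simp only [List.nodup_cons, List.mem_cons] at hn
  omega

lemma IsPermOf.exists_iterate_peaklessUpTo {n : ℕ} {p : List ℕ} (hp : IsPermOf n p) (j d : ℕ)
    (hd : j + 2 + d = n) :
    ∃ t, PeaklessUpTo (j + 2) (SC231^[t] p) ∧ 2 * t + (d + 1) * (d + 2) ≤ n * (n - 1) := by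
  induction j generalizing d with
  | zero =>
    refine ⟨0, hp.peaklessUpTo_two, ?_⟩
    subst hd
    rw [show 0 + 2 + d - 1 = d + 1 by omega]
    linarith
  | succ j ih =>
    obtain ⟨t, ht, hle⟩ := ih (d + 1) (by omega)
    obtain ⟨t', ht', h'⟩ := (hp.iterate_SC231 t).exists_iterate_peaklessUpTo_succ ht (by omega)
    refine ⟨t' + t, by rwa [Function.iterate_add_apply], ?_⟩
    have : t' ≤ d + 2 := by omega
    linarith

lemma PeaklessUpTo.not_hasPeak {n : ℕ} {p : List ℕ} (h : PeaklessUpTo n p)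
    (hp : ∀ e ∈ p, e ≤ n) : ¬ HasPeak p := by
  rintro ⟨i, hi, h1, h2⟩
  rw [getElem!_pos p i (by omega), getElem!_pos p (i + 1) (by omega)] at h1
  rw [getElem!_pos p (i + 2) (by omega), getElem!_pos p (i + 1) (by omega)] at h2
  refine h p[i] p[i + 1] p[i + 2] ?_ (hp _ (List.getElem_mem _)) ⟨h1, h2⟩
  have hdrop : p.drop i = p[i] :: p[i + 1] :: p[i + 2] :: p.drop (i + 3) := by
    rw [← List.drop_eq_getElem_cons hi, ← List.drop_eq_getElem_cons (i := i + 1) (by omega),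
      ← List.drop_eq_getElem_cons (i := i) (by omega)]
  have hsub := List.drop_sublist i p
  rw [hdrop] at hsub
  exact (List.sublist_append_left _ (p.drop (i + 3))).trans hsub

/-- The maximum sort-number of a length-`n` permutation under `SC_231` is at most
`(n+1)(n-2)/2` for `n ≥ 3`. -/
theorem sortNum_upper_bound (n : ℕ) (hn : 3 ≤ n) (p : List ℕ) (hp : IsPermOf n p) :
    sortNum p ≤ (n + 1) * (n - 2) / 2 := by
  obtain ⟨t, ht, hle⟩ := hp.exists_iterate_peaklessUpTo (n - 2) 0 (by omega)
  obtain ⟨m, rfl⟩ := Nat.exists_eq_add_of_le hn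
  have hpk : ¬ HasPeak (SC231^[t] p) :=
    ht.not_hasPeak fun e he => by
      have := ((hp.iterate_SC231 t).mem_iff.1 he).2
      omega
  refine (Nat.sInf_le hpk).trans ?_
  rw [Nat.le_div_iff_mul_le two_pos]
  rw [show 3 + m - 1 = m + 2 by omega] at hle
  rw [show 3 + m - 2 = m + 1 by omega]
  linarith
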